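/- Let K be a separable metric space, let f, g : K → ℝ be bounded functions in B_{1/2}(K), and let ε > 0. Then i(f + g, ε) ≤ i(f, ε/2) + i(g, ε/2). -/

import Mathlib

open Filter Topology Set

noncomputable section

/-- A real-valued function is bounded. -/
def BddFun {X : Type*} (f : X → ℝ) : Prop := ∃ C, ∀ x, |f x| ≤ C

/-- `f ∈ DBSC(X)`: `f` is a difference of bounded lower semicontinuous functions. -/
def MemDBSC {X : Type*} [TopologicalSpace X] (f : X → ℝ) : Prop :=
  ∃ u v : X → ℝ, BddFun u ∧ BddFun v ∧ LowerSemicontinuous u ∧ LowerSemicontinuous v ∧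
    f = u - v

/-- The D-norm of `f`. -/
def DNorm {X : Type*} [TopologicalSpace X] (f : X → ℝ) : ℝ :=
  sInf {c | ∃ φ : ℕ → X → ℝ, (∀ j, Continuous (φ j)) ∧ (∀ x, Summable fun j => |φ j x|) ∧
    (∀ x, ∑' j, φ j x = f x) ∧ (∀ x, ∑' j, |φ j x| ≤ c)}

/-- The sup-norm of `f`. -/
def supNorm {X : Type*} (f : X → ℝ) : ℝ := ⨆ x, |f x|

/-- A simple D-function: a D-function taking finitely many values. -/
def SimpleD {X : Type*} [TopologicalSpace X] (f : X → ℝ) : Prop :=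
  MemDBSC f ∧ (Set.range f).Finite

/-- `f ∈ SD(X)`: `f` is a strong D-function. -/
def MemSD {X : Type*} [TopologicalSpace X] (f : X → ℝ) : Prop :=
  ∃ φ : ℕ → X → ℝ, (∀ n, SimpleD (φ n)) ∧
    Tendsto (fun n => DNorm (f - φ n)) atTop (𝓝 0)

/-- `f ∈ B_{1/2}(X)`: `f` is a uniform limit of D-functions. -/
def MemBHalf {X : Type*} [TopologicalSpace X] (f : X → ℝ) : Prop :=
  ∃ g : ℕ → X → ℝ, (∀ n, MemDBSC (g n)) ∧ TendstoUniformly g f atTop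

/-- The upper semicontinuous envelope `Uf`. -/
def uEnv {X : Type*} [TopologicalSpace X] (f : X → ℝ) (x : X) : ℝ :=
  sInf {c | ∃ V : Set X, IsOpen V ∧ x ∈ V ∧ sSup (f '' V) = c}

/-- The lower oscillation of `f` at `x`. -/
def losc {X : Type*} [TopologicalSpace X] (f : X → ℝ) (x : X) : ℝ :=
  sInf {c | ∃ V : Set X, IsOpen V ∧ x ∈ V ∧ sSup ((fun y => |f y - f x|) '' V) = c}

/-- The oscillation of `f`: `osc f = U (losc f)`. -/
def osc {X : Type*} [TopologicalSpace X] (f : X → ℝ) : X → ℝ := uEnv (losc f)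

/-- The oscillation sets `os_n(f, ε)`. -/
def osSet {X : Type*} [TopologicalSpace X] (f : X → ℝ) (ε : ℝ) : ℕ → Set X
  | 0 => Set.univ
  | n + 1 => {x | ∃ h : x ∈ osSet f ε n, ε ≤ osc ((osSet f ε n).restrict f) ⟨x, h⟩}

/-- The `ε`-oscillation index `i(f, ε) = sup {n : os_n(f,ε) ≠ ∅}`. -/
def oscIndex {X : Type*} [TopologicalSpace X] (f : X → ℝ) (ε : ℝ) : ℕ∞ :=
  ⨆ (m : ℕ) (_ : (osSet f ε m).Nonempty), (m : ℕ∞)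

/-- `f` has finite Baire index. -/
def FiniteBaireIndex {X : Type*} [TopologicalSpace X] (f : X → ℝ) : Prop :=
  ∃ n : ℕ, ∀ ε > 0, osSet f ε n = ∅

/-- The Baire index `i(f) = sup_{ε > 0} i(f, ε)`. -/
def baireIndex {X : Type*} [TopologicalSpace X] (f : X → ℝ) : ℕ∞ :=
  ⨆ (ε : ℝ) (_ : 0 < ε), oscIndex f ε

open scoped ENNReal

lemma uEnv_bddBelow {X : Type*} [TopologicalSpace X] {f : X → ℝ} (h0 : ∀ y, 0 ≤ f y) (x : X) :
    BddBelow {c | ∃ V : Set X, IsOpen V ∧ x ∈ V ∧ sSup (f '' V) = c} := by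
  refine ⟨0, ?_⟩
  rintro _ ⟨V, -, -, rfl⟩
  exact Real.sSup_nonneg (by rintro _ ⟨y, -, rfl⟩; exact h0 y)

lemma uEnv_nonneg {X : Type*} [TopologicalSpace X] {f : X → ℝ} (h0 : ∀ y, 0 ≤ f y) (x : X) :
    0 ≤ uEnv f x := by
  refine Real.sInf_nonneg ?_
  rintro _ ⟨V, -, -, rfl⟩
  exact Real.sSup_nonneg (by rintro _ ⟨y, -, rfl⟩; exact h0 y)

lemma uEnv_le_of_eventually_le {X : Type*} [TopologicalSpace X] {f : X → ℝ} {x : X} {d : ℝ}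
    (h0 : ∀ y, 0 ≤ f y) (h : ∀ᶠ y in 𝓝 x, f y ≤ d) : uEnv f x ≤ d := by
  obtain ⟨V, hV, hVo, hxV⟩ := eventually_nhds_iff.1 h
  refine (csInf_le (uEnv_bddBelow h0 x) ⟨V, hVo, hxV, rfl⟩).trans (csSup_le ⟨_, x, hxV, rfl⟩ ?_)
  rintro _ ⟨y, hy, rfl⟩
  exact hV y hy

lemma uEnv_lt_iff {X : Type*} [TopologicalSpace X] {f : X → ℝ} {C : ℝ}
    (h0 : ∀ y, 0 ≤ f y) (hC : ∀ y, f y ≤ C) (x : X) (c : ℝ) :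
    uEnv f x < c ↔ ∃ d < c, ∀ᶠ y in 𝓝 x, f y ≤ d := by
  constructor
  · intro h
    obtain ⟨_, ⟨V, hVo, hxV, rfl⟩, hlt⟩ :=
      exists_lt_of_csInf_lt (by exact ⟨_, univ, isOpen_univ, mem_univ x, rfl⟩) h
    refine ⟨_, hlt, mem_of_superset (hVo.mem_nhds hxV) fun y hy => le_csSup ⟨C, ?_⟩ ⟨y, hy, rfl⟩⟩
    rintro _ ⟨z, -, rfl⟩
    exact hC z
  · rintro ⟨d, hd, h⟩
    exact (uEnv_le_of_eventually_le h0 h).trans_lt hd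

lemma osc_lt_iff {X : Type*} [TopologicalSpace X] {f : X → ℝ} (hf : BddFun f) (x : X) (c : ℝ) :
    osc f x < c ↔ ∃ d < c, ∀ᶠ y in 𝓝 x, ∀ᶠ z in 𝓝 y, |f z - f y| ≤ d := by
  obtain ⟨C, hC⟩ := hf
  have hle (y z : X) : |f z - f y| ≤ C + C :=
    (abs_sub _ _).trans (add_le_add (hC z) (hC y))
  have h0 (y : X) : 0 ≤ losc f y := uEnv_nonneg (fun _ => abs_nonneg _) y
  have hlosc (y : X) : losc f y ≤ C + C :=
    uEnv_le_of_eventually_le (fun _ => abs_nonneg _) (Eventually.of_forall (hle y))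
  refine (uEnv_lt_iff h0 hlosc x c).trans ⟨?_, ?_⟩
  · rintro ⟨d, hd, h⟩
    obtain ⟨e, hde, hec⟩ := exists_between hd
    refine ⟨e, hec, h.mono fun y hy => ?_⟩
    obtain ⟨d', hd', h'⟩ :=
      (uEnv_lt_iff (fun _ => abs_nonneg _) (hle y) y e).1 (hy.trans_lt hde)
    exact h'.mono fun z hz => hz.trans hd'.le
  · rintro ⟨d, hd, h⟩
    exact ⟨d, hd, h.mono fun y hy => uEnv_le_of_eventually_le (fun _ => abs_nonneg _) hy⟩

/-- The oscillation of `f` along `L` stays below `ε` near `x`, a point which need not lie in `L`. -/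
def OscLTWithin {X : Type*} [TopologicalSpace X] (f : X → ℝ) (L : Set X) (ε : ℝ) (x : X) : Prop :=
  ∃ d < ε, ∀ᶠ y in 𝓝 x, ∀ᶠ z in 𝓝[L] y, |f z - f y| ≤ d

namespace OscLTWithin

variable {X : Type*} [TopologicalSpace X] {f g : X → ℝ} {A B L : Set X} {ε : ℝ} {x : X}

lemma mono (h : OscLTWithin f B ε x) (hAB : A ⊆ B) : OscLTWithin f A ε x := by
  obtain ⟨d, hd, h⟩ := h
  exact ⟨d, hd, h.mono fun y hy => hy.filter_mono (nhdsWithin_mono y hAB)⟩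

lemma union (hA : OscLTWithin f A ε x) (hB : OscLTWithin f B ε x) :
    OscLTWithin f (A ∪ B) ε x := by
  obtain ⟨d, hd, hA⟩ := hA
  obtain ⟨e, he, hB⟩ := hB
  refine ⟨max d e, max_lt hd he, ?_⟩
  filter_upwards [hA, hB] with y hyA hyB
  rw [nhdsWithin_union, eventually_sup]
  exact ⟨hyA.mono fun z hz => hz.trans (le_max_left d e),
    hyB.mono fun z hz => hz.trans (le_max_right d e)⟩

lemma biUnion {ι : Type*} (s : Finset ι) {A : ι → Set X}
    (h : ∀ i ∈ s, OscLTWithin f (A i) ε x) : OscLTWithin f (⋃ i ∈ s, A i) ε x := by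
  classical
  induction s using Finset.induction_on with
  | empty => exact ⟨ε - 1, by linarith, by simp⟩
  | insert a s _ ih =>
    rw [Finset.set_biUnion_insert]
    exact (h a (Finset.mem_insert_self a s)).union
      (ih fun i hi => h i (Finset.mem_insert_of_mem hi))

lemma add {δ : ℝ} (hf : OscLTWithin f L ε x) (hg : OscLTWithin g L δ x) :
    OscLTWithin (f + g) L (ε + δ) x := by
  obtain ⟨d, hd, hf⟩ := hf
  obtain ⟨e, he, hg⟩ := hg
  refine ⟨d + e, add_lt_add hd he, ?_⟩
  filter_upwards [hf, hg] with y hyf hyg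
  filter_upwards [hyf, hyg] with z hzf hzg
  rw [Pi.add_apply, Pi.add_apply, add_sub_add_comm]
  exact (abs_add_le _ _).trans (add_le_add hzf hzg)

lemma of_notMem (hL : IsClosed L) (hx : x ∉ L) : OscLTWithin f L ε x := by
  refine ⟨ε - 1, by linarith, mem_of_superset (hL.isOpen_compl.mem_nhds hx) fun y hy => ?_⟩
  have hbot : 𝓝[L] y = ⊥ := by
    rwa [← notMem_closure_iff_nhdsWithin_eq_bot, hL.closure_eq]
  simp [hbot]

end OscLTWithin

lemma isClosed_setOf_not_oscLTWithin {X : Type*} [TopologicalSpace X] (f : X → ℝ) (L : Set X)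
    (ε : ℝ) : IsClosed {x | ¬ OscLTWithin f L ε x} := by
  rw [← isOpen_compl_iff, isOpen_iff_eventually]
  intro x hx
  obtain ⟨d, hd, h⟩ := not_not.1 hx
  exact (eventually_eventually_nhds.2 h).mono fun y hy => not_not.2 ⟨d, hd, hy⟩

lemma osc_domRestrict_lt_iff {X : Type*} [TopologicalSpace X] {f : X → ℝ} (hf : BddFun f)
    {L : Set X} (hL : IsClosed L) (x : L) (c : ℝ) :
    osc (L.domRestrict f) x < c ↔ OscLTWithin f L c x := by
  have hb : BddFun (L.domRestrict f) := hf.imp fun C hC y => hC y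
  have hnhds (y : L) (p : X → Prop) : (∀ᶠ z : L in 𝓝 y, p z) ↔ ∀ᶠ z in 𝓝[L] (y : X), p z := by
    rw [← map_nhds_subtype_val, eventually_map]
  rw [osc_lt_iff hb]
  refine exists_congr fun d => and_congr_right fun _ => ?_
  have hinner (y : L) : (∀ᶠ z in 𝓝 y, |L.domRestrict f z - L.domRestrict f y| ≤ d) ↔
      ∀ᶠ z in 𝓝[L] (y : X), |f z - f y| ≤ d := hnhds y fun z => |f z - f y| ≤ d
  simp_rw [hinner]
  rw [hnhds x fun y => ∀ᶠ z in 𝓝[L] y, |f z - f y| ≤ d, eventually_nhdsWithin_iff]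
  refine eventually_congr (Eventually.of_forall fun y => ⟨fun h => ?_, fun h _ => h⟩)
  by_cases hy : y ∈ L
  · exact h hy
  · have hbot : 𝓝[L] y = ⊥ := by
      rwa [← notMem_closure_iff_nhdsWithin_eq_bot, hL.closure_eq]
    simp [hbot]

lemma osSet_succ_of_isClosed {X : Type*} [TopologicalSpace X] {f : X → ℝ} (hf : BddFun f)
    {ε : ℝ} {n : ℕ} (hL : IsClosed (osSet f ε n)) :
    osSet f ε (n + 1) = {x | ¬ OscLTWithin f (osSet f ε n) ε x} := by
  ext x
  refine ⟨fun ⟨hx, h⟩ hlt => h.not_gt ((osc_domRestrict_lt_iff hf hL ⟨x, hx⟩ ε).2 hlt), fun h => ?_⟩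
  have hx : x ∈ osSet f ε n := by
    by_contra hx
    exact h (.of_notMem hL hx)
  exact ⟨hx, not_lt.1 fun hlt => h ((osc_domRestrict_lt_iff hf hL ⟨x, hx⟩ ε).1 hlt)⟩

lemma isClosed_osSet {X : Type*} [TopologicalSpace X] {f : X → ℝ} (hf : BddFun f) (ε : ℝ)
    (n : ℕ) : IsClosed (osSet f ε n) := by
  induction n with
  | zero => exact isClosed_univ
  | succ n ih =>
    rw [osSet_succ_of_isClosed hf ih]
    exact isClosed_setOf_not_oscLTWithin f _ ε

lemma mem_osSet_succ {X : Type*} [TopologicalSpace X] {f : X → ℝ} (hf : BddFun f) {ε : ℝ}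
    {n : ℕ} {x : X} : x ∈ osSet f ε (n + 1) ↔ ¬ OscLTWithin f (osSet f ε n) ε x := by
  rw [osSet_succ_of_isClosed hf (isClosed_osSet hf ε n), mem_ofPred_eq]

lemma BddFun.add {X : Type*} {f g : X → ℝ} (hf : BddFun f) (hg : BddFun g) : BddFun (f + g) := by
  obtain ⟨C, hC⟩ := hf
  obtain ⟨D, hD⟩ := hg
  exact ⟨C + D, fun x => (abs_add_le _ _).trans (add_le_add (hC x) (hD x))⟩

lemma osSet_add_subset {X : Type*} [TopologicalSpace X] {f g : X → ℝ} (hf : BddFun f)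
    (hg : BddFun g) (ε δ : ℝ) (n : ℕ) :
    osSet (f + g) (ε + δ) n ⊆
      ⋃ p ∈ Finset.HasAntidiagonal.antidiagonal n, osSet f ε p.1 ∩ osSet g δ p.2 := by
  induction n with
  | zero => simp [osSet]
  | succ n ih =>
    intro x hx
    rw [mem_osSet_succ (hf.add hg)] at hx
    by_contra hnot
    simp only [mem_iUnion, Finset.HasAntidiagonal.mem_antidiagonal, not_exists] at hnot
    refine hx (OscLTWithin.mono (OscLTWithin.biUnion _ fun p hp => ?_) ih)
    rw [Finset.HasAntidiagonal.mem_antidiagonal] at hp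
    have hclosed := (isClosed_osSet hf ε p.1).inter (isClosed_osSet hg δ p.2)
    by_cases hxp : x ∈ osSet f ε p.1 ∩ osSet g δ p.2
    · have hxf : OscLTWithin f (osSet f ε p.1) ε x := by
        by_contra h
        exact hnot (p.1 + 1, p.2) (by omega) ⟨(mem_osSet_succ hf).2 h, hxp.2⟩
      have hxg : OscLTWithin g (osSet g δ p.2) δ x := by
        by_contra h
        exact hnot (p.1, p.2 + 1) (by omega) ⟨hxp.1, (mem_osSet_succ hg).2 h⟩
      exact (hxf.mono inter_subset_left).add (hxg.mono inter_subset_right)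
    · exact .of_notMem hclosed hxp

lemma le_oscIndex {X : Type*} [TopologicalSpace X] {f : X → ℝ} {ε : ℝ} {n : ℕ}
    (h : (osSet f ε n).Nonempty) : (n : ℕ∞) ≤ oscIndex f ε :=
  le_iSup₂ (f := fun (m : ℕ) (_ : (osSet f ε m).Nonempty) => (m : ℕ∞)) n h

/-- **Theorem 2.8 (a).** `i(f + g, ε) ≤ i(f, ε/2) + i(g, ε/2)`. -/
theorem oscIndex_add_le {K : Type*} [MetricSpace K]
    [TopologicalSpace.SeparableSpace K] (f g : K → ℝ)
    (hbf : BddFun f) (hbg : BddFun g)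
    (hf : MemBHalf f) (hg : MemBHalf g) (ε : ℝ) (hε : 0 < ε) :
    oscIndex (f + g) ε ≤ oscIndex f (ε / 2) + oscIndex g (ε / 2) := by
  refine iSup₂_le fun n ⟨x, hx⟩ => ?_
  rw [← add_halves ε] at hx
  obtain ⟨p, hp, hxf, hxg⟩ := mem_iUnion₂.1 (osSet_add_subset hbf hbg _ _ n hx)
  rw [← Finset.HasAntidiagonal.mem_antidiagonal.1 hp, Nat.cast_add]
  exact add_le_add (le_oscIndex ⟨x, hxf⟩) (le_oscIndex ⟨x, hxg⟩)
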